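/- arXiv:1607.05237 — 2 statements merged into one kernel-verified Lean document; each statement's English description precedes it below -/
import Mathlib

section
/- Let τ = ℕ and let t : ℕ be a System T term whose only free variable is α : ℕ → ℕ. Then there exists a bar S which secures fun α => ⟦t⟧(α) and such that ⟦B_{t°}⟧ satisfies the general bar-recursion equation GenBR_S. (Theorem 3.3.) -/
/-- Extension of a finite sequence `s` by infinitely many copies of `z` (the "hat"). -/
def ext {τ : Type*} (z : τ) (s : List τ) : ℕ → τ := fun n => s.getD n z

/-- Concatenation `s * β` of a finite sequence with an infinite one. -/
def cat {τ : Type*} (s : List τ) (β : ℕ → τ) : ℕ → τ :=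
  fun n => if h : n < s.length then s[n] else β (n - s.length)

/-- `S` is a bar: decidable, monotone, and hit by every infinite sequence. -/
def IsBar {τ : Type*} (S : List τ → Prop) : Prop :=
  (∀ s, S s ∨ ¬ S s) ∧ (∀ s t : List τ, S s → S (s ++ t)) ∧
    (∀ α : ℕ → τ, ∃ n : ℕ, S ((List.range n).map α))

/-- `S` secures `Y`: whenever `S s` holds, `fun β => Y (s * β)` is constant. -/
def Secures {τ : Type*} (S : List τ → Prop) (Y : (ℕ → τ) → ℕ) : Prop :=
  ∀ s, S s → ∀ β β' : ℕ → τ, Y (cat s β) = Y (cat s β')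

/-- The general bar-recursion equation for the bar `S`. -/
def GenBR {τ σ : Type*} (S : List τ → Prop)
    (Δ : (List τ → σ) → (List τ → (τ → σ) → σ) → List τ → σ) : Prop :=
  ∀ G H s, (S s → Δ G H s = G s) ∧
    (¬ S s → Δ G H s = H s (fun x => Δ G H (s ++ [x])))

/-- Spector's bar-recursion equation for the stopping functional `Y`. -/
def SpectorBR {τ σ : Type*} (z : τ) (Y : (ℕ → τ) → ℕ)
    (ξ : (List τ → σ) → (List τ → (τ → σ) → σ) → List τ → σ) : Prop :=
  ∀ G H s, (Y (ext z s) < s.length → ξ G H s = G s) ∧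
    (s.length ≤ Y (ext z s) → ξ G H s = H s (fun x => ξ G H (s ++ [x])))

/-- The auxiliary functional `φ`. -/
def phi {τ σ : Type*} (G : List τ → σ) (H : List τ → (τ → σ) → σ) : ℕ → List τ → σ
  | 0 => G
  | n + 1 => fun s => H s (fun x => phi G H n (s ++ [x]))

/-- The functional `Ψ`, bar recursion for a constant stopping functional. -/
def psi {τ σ : Type*} (k : ℕ) (G : List τ → σ) (H : List τ → (τ → σ) → σ)
    (s : List τ) : σ :=
  if s.length > k then G s else phi G H (k + 1 - s.length) s

/-- Simple finite types, built only from `ℕ` and `→`. -/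
inductive Ty where
  | nat : Ty
  | arr : Ty → Ty → Ty

/-- Set-theoretic semantics of simple types. -/
def Ty.sem : Ty → Type
  | .nat => ℕ
  | .arr a b => a.sem → b.sem

/-- Typed de Bruijn indices into a context. -/
inductive Idx {κ : Type} : List κ → κ → Type where
  | zero {Γ ρ} : Idx (ρ :: Γ) ρ
  | succ {Γ ρ η} : Idx Γ ρ → Idx (η :: Γ) ρ

/-- Semantic environments for a context. -/
def Env {κ : Type} (f : κ → Type*) : List κ → Type _
  | [] => PUnit
  | ρ :: Γ => f ρ × Env f Γ

/-- Looking up a variable in an environment. -/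
def Idx.lookup {κ : Type} {f : κ → Type*} : ∀ {Γ : List κ} {ρ : κ}, Idx Γ ρ → Env f Γ → f ρ
  | _, _, .zero, e => e.1
  | _, _, .succ v, e => v.lookup e.2

/-- Terms of Gödel's System T over the simple types, in a context `Γ`, with a
distinguished variable (constant) `alpha : ℕ → τv`, the constants `0`, `Succ`,
and the recursors `Rec^ℕ` and `Rec^{ρ → ℕ}` of the paper. -/
inductive Tm (τv : Ty) : List Ty → Ty → Type where
  | var {Γ ρ} : Idx Γ ρ → Tm τv Γ ρ
  | lam {Γ a b} : Tm τv (a :: Γ) b → Tm τv Γ (.arr a b)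
  | app {Γ a b} : Tm τv Γ (.arr a b) → Tm τv Γ a → Tm τv Γ b
  | zero {Γ} : Tm τv Γ .nat
  | succ {Γ} : Tm τv Γ (.arr .nat .nat)
  | alpha {Γ} : Tm τv Γ (.arr .nat τv)
  | recN {Γ} : Tm τv Γ (.arr .nat (.arr (.arr .nat (.arr .nat .nat)) (.arr .nat .nat)))
  | recA {Γ} (ρ : Ty) : Tm τv Γ (.arr (.arr ρ .nat)
      (.arr (.arr .nat (.arr (.arr ρ .nat) (.arr ρ .nat))) (.arr .nat (.arr ρ .nat))))

/-- Standard set-theoretic semantics of terms, parametrized by the value of `alpha`. -/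
def Tm.sem {τv : Ty} : ∀ {Γ ρ}, Tm τv Γ ρ → (ℕ → τv.sem) → Env Ty.sem Γ → ρ.sem
  | _, _, .var v, _, e => v.lookup e
  | _, _, .lam t, α, e => fun x => t.sem α (x, e)
  | _, _, .app u v, α, e => u.sem α e (v.sem α e)
  | _, _, .zero, _, _ => (0 : ℕ)
  | _, _, .succ, _, _ => Nat.succ
  | _, _, .alpha, α, _ => α
  | _, _, .recN, _, _ => fun a f n => Nat.rec (motive := fun _ => ℕ) a f n
  | _, _, .recA ρ, _, _ => fun a f n => Nat.rec (motive := fun _ => Ty.sem ρ → ℕ) a f n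

/-- Semantics of the type translation `ρ ↦ ρ°` (case `τ = ℕ`), for result type `σS`:
`ℕ°` is interpreted by `((ℕ → ℕ) → ℕ) × ((ℕ* → σ) → (ℕ* → (ℕ → σ) → σ) → ℕ* → σ)`
and `(ρ₀ → ρ₁)°` by functions. -/
def TyC (σS : Type*) : Ty → Type _
  | .nat => ((ℕ → ℕ) → ℕ) ×
      ((List ℕ → σS) → (List ℕ → (ℕ → σS) → σS) → List ℕ → σS)
  | .arr a b => TyC σS a → TyC σS b

/-- The interpretation of the numeral translation `k° = ⟨λα.k, λG H.G⟩`. -/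
def kc (σS : Type*) (k : ℕ) : TyC σS .nat := ⟨fun _ => k, fun G _ => G⟩

/-- Semantics of the term translation `t ↦ t°` (case `τ = ℕ`), following
Definition 3.1 of the paper clause by clause. -/
def Tm.csem (σS : Type*) : ∀ {Γ ρ}, Tm .nat Γ ρ → Env (TyC σS) Γ → TyC σS ρ
  | _, _, .var v, e => v.lookup e
  | _, _, .lam t, e => fun x => t.csem σS (x, e)
  | _, _, .app u v, e => u.csem σS e (v.csem σS e)
  | _, _, .zero, _ => ⟨fun _ => (0 : ℕ), fun G _ => G⟩
  | _, _, .succ, _ => fun x => ⟨fun α => Nat.succ (x.1 α), x.2⟩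
  | _, _, .alpha, _ => fun x =>
      ⟨fun α => α (x.1 α),
       fun G H => x.2 (fun s' => psi (x.1 (ext 0 s')) G H s') H⟩
  | _, _, .recN, _ => fun a F x =>
      let r : ℕ → TyC σS .nat :=
        fun n => Nat.rec (motive := fun _ => TyC σS .nat) a (fun k ih => F (kc σS k) ih) n
      ⟨fun α => (r (x.1 α)).1 α,
       fun G H s => x.2 (fun s' => (r (x.1 (ext 0 s'))).2 G H s') H s⟩
  | _, _, .recA ρ, _ => fun a F x v =>
      let r : ℕ → TyC σS (.arr ρ .nat) :=
        fun n => Nat.rec (motive := fun _ => TyC σS (.arr ρ .nat)) a (fun k ih => F (kc σS k) ih) n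
      ⟨fun α => (r (x.1 α) v).1 α,
       fun G H s => x.2 (fun s' => (r (x.1 (ext 0 s')) v).2 G H s') H s⟩


theorem ext_append {τ : Type*} (z : τ) (s t : List τ) : ext z (s ++ t) = cat s (ext z t) := by
  funext n
  by_cases h : n < s.length
  · simp [ext, cat, h, List.getElem?_append_left]
  · simp [ext, cat, h, List.getElem?_append_right (Nat.le_of_not_lt h)]

theorem ext_eq_cat {τ : Type*} (z : τ) (s : List τ) : ext z s = cat s (fun _ => z) := by
  have h := ext_append z s []
  rw [List.append_nil] at h
  exact h

theorem cat_map_range {τ : Type*} (α : ℕ → τ) (n : ℕ) :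
    cat ((List.range n).map α) (fun i => α (n + i)) = α := by
  funext i
  by_cases h : i < n
  · simp [cat, h]
  · simp [cat, h, Nat.add_sub_cancel' (Nat.le_of_not_lt h)]

theorem map_range_add {τ : Type*} (α : ℕ → τ) (m n : ℕ) :
    (List.range (m + n)).map α = (List.range m).map α ++ (List.range n).map (fun i => α (m + i)) := by
  simp [List.range_add, Function.comp_def]

theorem IsBar.of_le {τ : Type*} {S : List τ → Prop} (hS : IsBar S) {α : ℕ → τ} {m n : ℕ}
    (h : S ((List.range m).map α)) (hmn : m ≤ n) : S ((List.range n).map α) := by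
  obtain ⟨k, rfl⟩ := Nat.exists_eq_add_of_le hmn
  rw [map_range_add]
  exact hS.2.1 _ _ h

theorem Secures.ext_append {τ : Type*} {S : List τ → Prop} {Y : (ℕ → τ) → ℕ} (hY : Secures S Y)
    (z : τ) {s : List τ} (hs : S s) (t : List τ) : Y (ext z (s ++ t)) = Y (ext z s) := by
  rw [_root_.ext_append, ext_eq_cat z s]
  exact hY s hs _ _

theorem Secures.cat_eq_ext {τ : Type*} {S : List τ → Prop} {Y : (ℕ → τ) → ℕ} (hY : Secures S Y)
    (z : τ) {s : List τ} (hs : S s) (β : ℕ → τ) : Y (cat s β) = Y (ext z s) := by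
  rw [ext_eq_cat]
  exact hY s hs _ _

/-- Some bar secures the first component of `x`, and the second component of `x` satisfies the
general bar-recursion equation for it. -/
def HasBar {τ σ : Type*}
    (x : ((ℕ → τ) → ℕ) × ((List τ → σ) → (List τ → (τ → σ) → σ) → List τ → σ)) : Prop :=
  ∃ S : List τ → Prop, IsBar S ∧ Secures S x.1 ∧ GenBR S x.2

theorem hasBar_kc (σS : Type*) (k : ℕ) : HasBar (kc σS k) :=
  ⟨fun _ => True, ⟨fun _ => Or.inl trivial, fun _ _ _ => trivial, fun _ => ⟨0, trivial⟩⟩,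
    fun _ _ _ _ => rfl, fun _ _ _ => ⟨fun _ => rfl, fun h => (h trivial).elim⟩⟩

theorem genBR_psi {τ σ : Type*} (k : ℕ) :
    GenBR (fun s : List τ => k < s.length) (psi (σ := σ) k) := by
  intro G H s
  refine ⟨fun h => if_pos h, fun h => ?_⟩
  have hk : k + 1 - s.length = (k - s.length) + 1 := by omega
  rw [psi, if_neg h, hk, phi]
  refine congrArg (H s) (funext fun x => ?_)
  by_cases hx : (s ++ [x]).length > k
  · have h0 : k - s.length = 0 := by
      rw [List.length_append, List.length_singleton] at hx
      omega
    rw [psi, if_pos hx, h0, phi]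
  · have h1 : k + 1 - (s ++ [x]).length = k - s.length := by
      rw [List.length_append, List.length_singleton]
      omega
    rw [psi, if_neg hx, h1]

theorem hasBar_eval_psi (σ : Type*) (k : ℕ) :
    HasBar (σ := σ) (fun α : ℕ → ℕ => α k, psi k) := by
  refine ⟨fun s => k < s.length, ⟨fun s => em _, fun s t h => ?_, fun α => ⟨k + 1, by simp⟩⟩,
    fun s hs β β' => ?_, genBR_psi k⟩
  · exact h.trans_le (by simp)
  · simp [cat, hs]

/-- Composition of bars: first secure the value of `Y`, then the member of the family `r`
selected by that value. -/
theorem HasBar.bind {τ σ : Type*} (z : τ)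
    {x : ((ℕ → τ) → ℕ) × ((List τ → σ) → (List τ → (τ → σ) → σ) → List τ → σ)}
    {r : ℕ → ((ℕ → τ) → ℕ) × ((List τ → σ) → (List τ → (τ → σ) → σ) → List τ → σ)}
    (hx : HasBar x) (hr : ∀ n, HasBar (r n)) :
    HasBar (fun α => (r (x.1 α)).1 α,
      fun G H s => x.2 (fun s' => (r (x.1 (ext z s'))).2 G H s') H s) := by
  obtain ⟨S, hS, hY, hB⟩ := hx
  choose T hT hTY hTB using hr
  refine ⟨fun s => S s ∧ T (x.1 (ext z s)) s, ⟨fun s => em _, ?_, fun α => ?_⟩, ?_, ?_⟩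
  · rintro s t ⟨hs, ht⟩
    refine ⟨hS.2.1 s t hs, ?_⟩
    rw [hY.ext_append z hs]
    exact (hT _).2.1 s t ht
  · obtain ⟨m, hm⟩ := hS.2.2 α
    obtain ⟨n, hn⟩ := (hT (x.1 α)).2.2 α
    have hmn := hS.of_le hm (le_max_left m n)
    refine ⟨max m n, hmn, ?_⟩
    rw [← hY.cat_eq_ext z hmn (fun i => α (max m n + i)), cat_map_range]
    exact (hT _).of_le hn (le_max_right m n)
  · rintro s ⟨hs, ht⟩ β β'
    simp only [hY.cat_eq_ext z hs]
    exact hTY _ s ht β β'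
  · intro G H s
    by_cases hs : S s
    · have h := hTB (x.1 (ext z s)) G H s
      dsimp only
      rw [(hB _ H s).1 hs]
      refine ⟨fun ht => h.1 ht.2, fun ht => ?_⟩
      rw [h.2 fun h' => ht ⟨hs, h'⟩]
      congr 1
      funext y
      rw [(hB _ H _).1 (hS.2.1 s [y] hs), hY.ext_append z hs]
    · exact ⟨fun ht => (hs ht.1).elim, fun _ => (hB _ H s).2 hs⟩

/-- The logical relation between families of values indexed by `α` and the interpretations of
translated terms. -/
def LogRel (σS : Type*) : ∀ ρ : Ty, ((ℕ → ℕ) → ρ.sem) → TyC σS ρ → Prop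
  | .nat, f, x => f = x.1 ∧ HasBar x
  | .arr a b, f, g => ∀ h x, LogRel σS a h x → LogRel σS b (fun α => f α (h α)) (g x)

theorem LogRel.natRec {σS : Type*} {ρ : Ty} {a : (ℕ → ℕ) → ρ.sem}
    {f : (ℕ → ℕ) → (Ty.arr .nat (.arr ρ ρ)).sem} {a' : TyC σS ρ}
    {f' : TyC σS (.arr .nat (.arr ρ ρ))} (ha : LogRel σS ρ a a')
    (hf : LogRel σS (.arr .nat (.arr ρ ρ)) f f') (n : ℕ) :
    LogRel σS ρ (fun α => Nat.rec (motive := fun _ => ρ.sem) (a α) (f α) n)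
      (Nat.rec (motive := fun _ => TyC σS ρ) a' (fun k ih => f' (kc σS k) ih) n) := by
  induction n with
  | zero => exact ha
  | succ n ih => exact hf (fun _ => n) (kc σS n) ⟨rfl, hasBar_kc σS n⟩ _ _ ih

/-- The fundamental lemma of the logical relation. -/
theorem Tm.logRel (σS : Type*) {Γ : List Ty} {ρ : Ty} (t : Tm .nat Γ ρ)
    (e : (ℕ → ℕ) → Env Ty.sem Γ) (e' : Env (TyC σS) Γ)
    (he : ∀ (η : Ty) (v : Idx Γ η), LogRel σS η (fun α => v.lookup (e α)) (v.lookup e')) :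
    LogRel σS ρ (fun α => t.sem α (e α)) (t.csem σS e') := by
  induction t with
  | var v => exact he _ v
  | lam t ih =>
    intro h x hx
    refine ih (fun α => (h α, e α)) (x, e') fun η v => ?_
    cases v with
    | zero => exact hx
    | succ v => exact he η v
  | app u v ihu ihv => exact ihu e e' he _ _ (ihv e e' he)
  | zero => exact ⟨rfl, hasBar_kc σS 0⟩
  | succ =>
    rintro h x ⟨rfl, S, hS, hY, hB⟩
    exact ⟨rfl, S, hS, fun s hs β β' => congrArg Nat.succ (hY s hs β β'), hB⟩
  | alpha =>
    rintro h x ⟨rfl, hx⟩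
    exact ⟨rfl, hx.bind 0 (hasBar_eval_psi σS)⟩
  | recN =>
    rintro a a' ha f f' hf h x ⟨rfl, hx⟩
    have hr := LogRel.natRec ha hf
    exact ⟨funext fun α => congrFun (hr (x.1 α)).1 α, hx.bind 0 fun n => (hr n).2⟩
  | recA ρ =>
    rintro a a' ha f f' hf h x ⟨rfl, hx⟩ w v hv
    have hr := fun n => LogRel.natRec (ρ := .arr ρ .nat) ha hf n w v hv
    exact ⟨funext fun α => congrFun (hr (x.1 α)).1 α, hx.bind 0 fun n => (hr n).2⟩

/-- Theorem 3.3 (case `τ = ℕ`): for every System T term `t : ℕ` whose only free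
variable is `α : ℕ → ℕ`, there is a bar `S` securing `fun α => ⟦t⟧(α)` such that
`⟦B_{t°}⟧` satisfies the general bar-recursion equation for `S`. -/
theorem exists_bar_securing (σS : Type*) (t : Tm .nat [] .nat) :
    ∃ S : List ℕ → Prop, IsBar S ∧ Secures S (fun α => t.sem α PUnit.unit) ∧
      GenBR S (t.csem σS PUnit.unit).2 := by
  obtain ⟨ht, h⟩ := t.logRel σS (fun _ => PUnit.unit) PUnit.unit (fun _ v => nomatch v)
  rw [ht]
  exact h
end

section
/- Let τ = ℕ with 0_τ = 0. Suppose S_x is a bar securing g : (ℕ → ℕ) → ℕ and B_x satisfies GenBR_{S_x}(B_x); and suppose (S_n)_{n ∈ ℕ} is a family of bars and (B_n)_{n ∈ ℕ} a family of functionals such that for each n, B_n satisfies GenBR_{S_n}(B_n). Define S s := S_x s ∧ S_{g ŝ} s and Δ G H s := B_x (fun s' => B_{g ŝ'} G H s') H s. Then Δ satisfies GenBR_S(Δ). (Claim 3 in the recursor case of the proof of Theorem 3.3.) -/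
theorem cat_ext {τ : Type*} (z : τ) (s t : List τ) : cat s (ext z t) = ext z (s ++ t) := by
  funext n
  unfold cat ext
  split_ifs with h
  · simp [List.getD_eq_getElem?_getD, List.getElem?_append_left h, h]
  · rw [List.getD_append_right _ _ _ _ (not_lt.mp h)]

theorem Secures.apply_ext_append {τ : Type*} {S : List τ → Prop} {Y : (ℕ → τ) → ℕ}
    (h : Secures S Y) {s : List τ} (hs : S s) (z : τ) (t : List τ) :
    Y (ext z (s ++ t)) = Y (ext z s) := by
  simpa only [cat_ext, List.append_nil] using h s hs (ext z t) (ext z [])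

/-- Claim 3 in the recursor case of the proof of Theorem 3.3 (`τ = ℕ`, `0_τ = 0`):
if `S_x` is a bar securing `g` with `GenBR_{S_x}(B_x)`, and each `S_n` is a bar with
`GenBR_{S_n}(B_n)`, then `Δ G H s := B_x (fun s' => B_{g ŝ'} G H s') H s` satisfies
`GenBR_S(Δ)` where `S s := S_x s ∧ S_{g ŝ} s`. -/
theorem rec_case_genBR {σ : Type*} (g : (ℕ → ℕ) → ℕ) (Sx : List ℕ → Prop)
    (hbarx : IsBar Sx) (hsecx : Secures Sx g)
    (Bx : (List ℕ → σ) → (List ℕ → (ℕ → σ) → σ) → List ℕ → σ)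
    (hBx : GenBR Sx Bx)
    (S : ℕ → List ℕ → Prop) (hbar : ∀ n, IsBar (S n))
    (B : ℕ → (List ℕ → σ) → (List ℕ → (ℕ → σ) → σ) → List ℕ → σ)
    (hB : ∀ n, GenBR (S n) (B n)) :
    GenBR (fun s : List ℕ => Sx s ∧ S (g (ext 0 s)) s)
      (fun G H s => Bx (fun s' => B (g (ext 0 s')) G H s') H s) := by
  intro G H s
  by_cases hs : Sx s
  · have hΔ := (hBx (fun s' => B (g (ext 0 s')) G H s') H s).1 hs
    refine ⟨fun h => hΔ.trans ((hB _ G H s).1 h.2), fun h => ?_⟩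
    refine hΔ.trans (((hB _ G H s).2 fun h' => h ⟨hs, h'⟩).trans (congrArg (H s) ?_))
    funext x
    beta_reduce
    rw [(hBx _ H (s ++ [x])).1 (hbarx.2.1 s [x] hs), hsecx.apply_ext_append hs]
  · exact ⟨fun h => absurd h.1 hs, fun _ => (hBx _ H s).2 hs⟩
end
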